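/- Let t, s₁, s₂ be natural numbers, let n, m : Fin t → ℕ, and let k₁, l₁ : Fin s₁ → Fin t and k₂, l₂ : Fin s₂ → Fin t. Suppose given two systems 𝒜 and ℬ: system 𝒜 consists of bilinear forms A_i : ℂ^{n(k₁ i)} × ℂ^{n(l₁ i)} → ℂ for i ∈ Fin s₁ and sesquilinear forms A'_j : ℂ^{n(k₂ j)} × ℂ^{n(l₂ j)} → ℂ (linear in the first argument, conjugate-linear in the second) for j ∈ Fin s₂; system ℬ consists of bilinear forms B_i : ℂ^{m(k₁ i)} × ℂ^{m(l₁ i)} → ℂ and sesquilinear forms B'_j : ℂ^{m(k₂ j)} × ℂ^{m(l₂ j)} → ℂ with the same index maps. Then there exists a family of homeomorphisms φ_p : ℂ^{n(p)} → ℂ^{m(p)} (p ∈ Fin t) with A_i(u,v) = B_i(φ_{k₁ i} u, φ_{l₁ i} v) for all i, u, v and A'_j(u,v) = B'_j(φ_{k₂ j} u, φ_{l₂ j} v) for all j, u, v, if and only if there exists a family of linear bijections ψ_p : ℂ^{n(p)} → ℂ^{m(p)} satisfying the same identities with ψ in place of φ. -/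

import Mathlib

open Module MeasureTheory Metric Set Filter Topology

/-- A perturbation of the identity by a contraction is bijective. -/
theorem LipschitzWith.bijective_id_add {E : Type*} [NormedAddCommGroup E] [CompleteSpace E]
    {K : NNReal} (hK : K < 1) {w : E → E} (hw : LipschitzWith K w) :
    Function.Bijective fun x => x + w x := by
  constructor
  · intro x y hxy
    have h1 : ‖x - y‖ ≤ K * ‖x - y‖ := by
      have h2 := hw.norm_sub_le y x
      rwa [show w y - w x = x - y by
        rw [sub_eq_sub_iff_add_eq_add, add_comm (w y), add_comm]; simpa [add_comm] using hxy.symm,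
        norm_sub_rev y x] at h2
    have hK' : (K : ℝ) < 1 := hK
    have h3 : ‖x - y‖ = 0 := by nlinarith [norm_nonneg (x - y)]
    exact sub_eq_zero.1 (norm_eq_zero.1 h3)
  · intro y
    have hc : ContractingWith K fun x => y - w x :=
      ⟨hK, LipschitzWith.of_dist_le_mul fun a b => by
        simpa only [dist_sub_left] using hw.dist_le_mul a b⟩
    have h : y - w (hc.fixedPoint _) = hc.fixedPoint _ := hc.fixedPoint_isFixedPt
    exact ⟨hc.fixedPoint _, (sub_eq_iff_eq_add.1 h).symm⟩

/-- A function that is Lipschitz on a closed ball and vanishes on its sphere stays Lipschitz, with the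
same constant, when extended by zero. -/
theorem LipschitzOnWith.lipschitzWith_indicator_closedBall {E F : Type*} [NormedAddCommGroup E]
    [NormedSpace ℝ E] [NormedAddCommGroup F] {K : NNReal} {r : ℝ} {u : E → F}
    (hu : LipschitzOnWith K u (closedBall 0 r)) (h0 : ∀ x ∈ sphere (0 : E) r, u x = 0) :
    LipschitzWith K ((closedBall (0 : E) r).indicator u) := by
  have key : ∀ x ∈ closedBall (0 : E) r, ∀ y ∉ closedBall (0 : E) r, ‖u x‖ ≤ K * ‖x - y‖ := by
    intro x hx y hy
    rw [mem_closedBall_zero_iff] at hx hy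
    have hcont : ContinuousOn (fun s : ℝ => ‖AffineMap.lineMap x y s‖) (Icc 0 1) := by
      fun_prop
    obtain ⟨s, hs, hsr⟩ := intermediate_value_Icc zero_le_one hcont
      (show r ∈ Icc _ _ by simpa using ⟨hx, (not_le.1 hy).le⟩)
    set z : E := AffineMap.lineMap x y s with hz
    have hzs : z ∈ sphere (0 : E) r := by simpa using hsr
    have h1 := hu.norm_sub_le (mem_closedBall_zero_iff.2 hx) (sphere_subset_closedBall hzs)
    rw [h0 z hzs, sub_zero] at h1
    refine h1.trans (mul_le_mul_of_nonneg_left ?_ K.2)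
    rw [← dist_eq_norm, ← dist_eq_norm, dist_left_lineMap, Real.norm_of_nonneg hs.1]
    exact mul_le_of_le_one_left dist_nonneg hs.2
  refine LipschitzWith.of_dist_le_mul fun x y => ?_
  rw [dist_eq_norm, dist_eq_norm]
  by_cases hx : x ∈ closedBall (0 : E) r <;> by_cases hy : y ∈ closedBall (0 : E) r
  · simpa [hx, hy] using hu.norm_sub_le hx hy
  · simpa only [indicator_of_mem hx, indicator_of_notMem hy, sub_zero] using key x hx y hy
  · simpa only [indicator_of_notMem hx, indicator_of_mem hy, zero_sub, norm_neg,
      norm_sub_rev x y] using key y hy x hx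
  · simp only [indicator_of_notMem hx, indicator_of_notMem hy, sub_self, norm_zero]
    positivity

/-- Lagrange interpolation at small nodes recovers `det (1 + f)` from the values `det (1 + τ • f)`,
with weights that do not depend on `f`. -/
theorem exists_weights_det_one_add {E : Type*} [AddCommGroup E] [Module ℝ E]
    [FiniteDimensional ℝ E] {δ : ℝ} (hδ : 0 < δ) :
    ∃ (s : Finset ℝ) (c : ℝ → ℝ), (∀ τ ∈ s, 0 < τ ∧ τ < δ) ∧ ∑ τ ∈ s, c τ = 1 ∧
      ∀ f : E →ₗ[ℝ] E, LinearMap.det (1 + f) = ∑ τ ∈ s, c τ * LinearMap.det (1 + τ • f) := by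
  obtain ⟨s, hs, hcard⟩ := (Ioo_infinite hδ).exists_subset_card_eq (finrank ℝ E + 1)
  have key : ∀ p : Polynomial ℝ, p.natDegree ≤ finrank ℝ E →
      p.eval 1 = ∑ τ ∈ s, (Lagrange.basis s id τ).eval 1 * p.eval τ := by
    intro p hp
    have h := Lagrange.eq_interpolate (s := s) (v := id) (f := p) Function.injective_id.injOn <| by
      rw [hcard]
      exact (Polynomial.degree_le_of_natDegree_le hp).trans_lt (by exact_mod_cast Nat.lt_succ_self _)
    conv_lhs => rw [h, Lagrange.interpolate_apply]
    simp [Polynomial.eval_finsetSum, mul_comm]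
  refine ⟨s, fun τ => (Lagrange.basis s id τ).eval 1, fun τ hτ => hs hτ, ?_, fun f => ?_⟩
  · simpa using (key 1 (by simp)).symm
  · let b := finBasis ℝ E
    let M := LinearMap.toMatrix b b f
    let p : Polynomial ℝ := ((Polynomial.X : Polynomial ℝ) • M.map Polynomial.C +
      (1 : Matrix (Fin (finrank ℝ E)) (Fin (finrank ℝ E)) ℝ).map Polynomial.C).det
    have hp : ∀ τ : ℝ, p.eval τ = LinearMap.det (1 + τ • f) := by
      intro τ
      rw [← LinearMap.det_toMatrix b, map_add, map_smul, LinearMap.toMatrix_one,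
        ← Polynomial.coe_evalRingHom, RingHom.map_det]
      congr 1
      ext i j
      simp [M, Matrix.one_apply, apply_ite, add_comm, mul_comm τ]
    have h := key p ((Polynomial.natDegree_det_X_add_C_le _ _).trans (by simp))
    simpa [hp] using h

section

variable {E : Type*} [NormedAddCommGroup E] [InnerProductSpace ℝ E] [FiniteDimensional ℝ E]

/-- If `u` is `C¹` and vanishes on the unit sphere, then for small `t` the map `x ↦ x + t • u x`
permutes the unit ball, so its Jacobian determinant integrates to the volume of the ball. -/
theorem eventually_setIntegral_det_one_add_smul [MeasurableSpace E] [BorelSpace E] (μ : Measure E)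
    [μ.IsAddHaarMeasure] {u : E → E} (hu : ContDiff ℝ 1 u) (h0 : ∀ x ∈ sphere (0 : E) 1, u x = 0) :
    ∀ᶠ t : ℝ in 𝓝 0, ∫ x in ball (0 : E) 1, (1 + t • fderiv ℝ u x).det ∂μ =
      μ.real (ball 0 1) := by
  obtain ⟨K, hK⟩ := hu.contDiffOn.exists_lipschitzOnWith one_ne_zero (convex_closedBall (0 : E) 1)
    (isCompact_closedBall 0 1)
  have hv := hK.lipschitzWith_indicator_closedBall h0
  set v := (closedBall (0 : E) 1).indicator u with hv_def
  have hcont : Continuous fun z : ℝ × E => (1 + z.1 • fderiv ℝ u z.2).det := by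
    have := hu.continuous_fderiv one_ne_zero
    exact ContinuousLinearMap.continuous_det.comp (by fun_prop)
  have hpos : ∀ᶠ t : ℝ in 𝓝 0, ∀ x ∈ closedBall (0 : E) 1, 0 < (1 + t • fderiv ℝ u x).det := by
    refine (isCompact_closedBall (0 : E) 1).eventually_forall_of_forall_eventually fun x _ => ?_
    refine hcont.continuousAt.eventually (lt_mem_nhds ?_)
    simp [ContinuousLinearMap.det]
  have hsmall : ∀ᶠ t : ℝ in 𝓝 0, ‖t‖₊ * K < 1 := by
    have : Continuous fun t : ℝ => ‖t‖₊ * K := by fun_prop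
    exact this.continuousAt.eventually (gt_mem_nhds (by simp))
  filter_upwards [hpos, hsmall] with t htpos ht
  have hbij := LipschitzWith.bijective_id_add ht
    (w := fun x => t • v x) ((lipschitzWith_smul t).comp hv)
  set f : E → E := fun x => x + t • v x with hf
  have hv_out : ∀ x ∈ (ball (0 : E) 1)ᶜ, f x = x := by
    intro x hx
    have : v x = 0 := by
      by_cases hx' : x ∈ closedBall (0 : E) 1
      · rw [hv_def, indicator_of_mem hx']
        refine h0 x (mem_sphere.2 (le_antisymm (mem_closedBall.1 hx') ?_))
        simpa using hx
      · exact indicator_of_notMem hx' _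
    simp [hf, this]
  have himg : f '' ball 0 1 = ball 0 1 := by
    have h1 : f '' (ball (0 : E) 1)ᶜ = (ball 0 1)ᶜ := by
      rw [image_congr hv_out, image_id']
    rwa [image_compl_eq hbij, compl_inj_iff] at h1
  have hderiv : ∀ x ∈ ball (0 : E) 1,
      HasFDerivWithinAt f (1 + t • fderiv ℝ u x) (ball 0 1) x := by
    intro x hx
    have h1 : HasFDerivAt (fun x => x + t • u x) (1 + t • fderiv ℝ u x) x :=
      (hasFDerivAt_id x).add (((hu.differentiable one_ne_zero) x).hasFDerivAt.const_smul t)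
    refine h1.hasFDerivWithinAt.congr (fun y hy => ?_) ?_
    · simp only [hf, hv_def, indicator_of_mem (ball_subset_closedBall hy)]
    · simp only [hf, hv_def, indicator_of_mem (ball_subset_closedBall hx)]
  have h := integral_image_eq_integral_abs_det_fderiv_smul μ measurableSet_ball hderiv
    hbij.injective.injOn (fun _ => (1 : ℝ))
  rw [himg] at h
  simp only [setIntegral_const, smul_eq_mul, mul_one] at h
  rw [h]
  refine setIntegral_congr_fun measurableSet_ball fun x hx => ?_
  exact (abs_of_pos (htpos x (ball_subset_closedBall hx))).symm

/-- There is no `C¹` retraction onto the unit sphere. -/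
theorem not_exists_contDiff_retraction_sphere {r : E → E} (hr : ContDiff ℝ 1 r)
    (hnorm : ∀ x, ‖r x‖ = 1) : ¬ ∀ x ∈ sphere (0 : E) 1, r x = x := by
  intro hsph
  borelize E
  let μ : Measure E := Measure.addHaar
  let u : E → E := fun x => r x - x
  have hu : ContDiff ℝ 1 u := hr.sub contDiff_id
  have hfd : ∀ x, fderiv ℝ r x = 1 + fderiv ℝ u x := by
    intro x
    have h1 : fderiv ℝ u x = fderiv ℝ r x - 1 :=
      (((hr.differentiable one_ne_zero) x).hasFDerivAt.sub (hasFDerivAt_id x)).fderiv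
    rw [h1]
    abel
  have hdet : ∀ x, (1 + fderiv ℝ u x).det = 0 := by
    intro x
    rw [← hfd]
    by_contra hne
    have hr' := ((hr.differentiable one_ne_zero) x).hasFDerivAt
    have h2 := hr'.norm_sq
    have h3 : (fun x => ‖r x‖ ^ 2) = fun _ => (1 : ℝ) := by ext; simp [hnorm]
    rw [h3] at h2
    have h4 := h2.unique (hasFDerivAt_const (1 : ℝ) x)
    obtain ⟨w, hw⟩ := (LinearMap.equivOfDetNeZero (fderiv ℝ r x : E →ₗ[ℝ] E) hne).surjective (r x)
    have hw' : fderiv ℝ r x w = r x := hw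
    have h5 := congrArg (fun L : E →L[ℝ] ℝ => L w) h4
    simp [hw', hnorm] at h5
  obtain ⟨δ, hδ, hint⟩ := Metric.eventually_nhds_iff.1
    (eventually_setIntegral_det_one_add_smul μ hu fun x hx => by simp [u, hsph x hx])
  obtain ⟨s, c, hs, hc, hsum⟩ := exists_weights_det_one_add (E := E) hδ
  have hpos : 0 < μ.real (ball (0 : E) 1) :=
    ENNReal.toReal_pos (measure_ball_pos μ 0 one_pos).ne' measure_ball_lt_top.ne
  have hzero : ∫ x in ball (0 : E) 1, (1 + fderiv ℝ u x).det ∂μ = 0 := by simp [hdet]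
  have hone : ∫ x in ball (0 : E) 1, (1 + fderiv ℝ u x).det ∂μ = μ.real (ball 0 1) := by
    have h1 : ∀ x, (1 + fderiv ℝ u x).det = ∑ τ ∈ s, c τ * (1 + τ • fderiv ℝ u x).det :=
      fun x => hsum (fderiv ℝ u x : E →ₗ[ℝ] E)
    simp_rw [h1]
    rw [integral_finsetSum]
    · simp_rw [integral_const_mul]
      rw [Finset.sum_congr rfl fun τ hτ => by
        rw [hint (by simpa [abs_of_pos (hs τ hτ).1] using (hs τ hτ).2)], ← Finset.sum_mul, hc,
        one_mul]
    · intro τ _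
      have hcont : Continuous fun x : E => c τ * (1 + τ • fderiv ℝ u x).det := by
        have := hu.continuous_fderiv one_ne_zero
        exact continuous_const.mul (ContinuousLinearMap.continuous_det.comp (by fun_prop))
      exact (hcont.continuousOn.integrableOn_compact (isCompact_closedBall (0 : E) 1)).mono_set
        ball_subset_closedBall
  exact hpos.ne' (hone.symm.trans hzero)

/-- A continuous self-map at distance less than `1 / 2` from the identity has a zero. -/
theorem exists_eq_zero_of_norm_sub_lt {h : E → E} (hh : Continuous h)
    (hclose : ∀ x, ‖h x - x‖ < 1 / 2) : ∃ x, h x = 0 := by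
  by_contra! hne
  let χ : E → ℝ := fun x => max 0 (min 1 (3 - 4 * ‖x‖))
  have hχ0 : ∀ x, 0 ≤ χ x := fun x => le_max_left _ _
  have hχ1 : ∀ x, χ x ≤ 1 := fun x => max_le zero_le_one (min_le_left _ _)
  let g : E → E := fun x => x + χ x • (h x - x)
  have hg : Continuous g := by fun_prop
  have hgne : ∀ x, g x ≠ 0 := by
    intro x hx
    rcases le_or_gt ‖x‖ (1 / 2) with hx2 | hx2
    · have : χ x = 1 := by
        simp only [χ]
        rw [min_eq_left (by linarith), max_eq_right zero_le_one]
      exact hne x (by simpa [g, this] using hx)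
    · have h1 : ‖x‖ = ‖χ x • (h x - x)‖ := by
        simpa only [norm_neg] using congrArg norm (eq_neg_of_add_eq_zero_left hx)
      rw [norm_smul, Real.norm_of_nonneg (hχ0 x)] at h1
      nlinarith [hχ1 x, hχ0 x, hclose x, norm_nonneg (h x - x)]
  have hgid : ∀ x : E, 3 / 4 < ‖x‖ → g x = x := by
    intro x hx
    have : χ x = 0 := max_eq_left ((min_le_right _ _).trans (by linarith))
    simp [g, this]
  have hU : IsOpen {x : E | 3 / 4 < ‖x‖} := isOpen_lt continuous_const continuous_norm
  obtain ⟨k, hk, hkg, hkeq, -⟩ := hg.exists_contDiff_approx_and_eqOn 1 (ε := fun x => ‖g x‖)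
    hg.norm (fun x => norm_pos_iff.2 (hgne x)) (S := sphere 0 1) isClosed_sphere
    (U := {x : E | 3 / 4 < ‖x‖})
    (hU.mem_nhdsSet.2 fun x hx => by
      rw [mem_sphere_zero_iff_norm] at hx
      simp only [mem_ofPred_eq, hx]
      norm_num)
    (contDiffOn_id.congr hgid)
  have hkne : ∀ x, k x ≠ 0 := by
    intro x hx
    have := hkg x
    simp [hx] at this
  have hk1 : ContDiff ℝ 1 k := by exact_mod_cast hk
  refine not_exists_contDiff_retraction_sphere (r := fun x => ‖k x‖⁻¹ • k x)
    (((hk1.norm ℝ hkne).inv fun x => norm_ne_zero_iff.2 (hkne x)).smul hk1) ?_ ?_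
  · intro x
    simp [norm_smul, hkne x]
  · intro x hx
    have hx' : ‖x‖ = 1 := by simpa using hx
    have : k x = x := (hkeq hx).trans (hgid x (by rw [hx']; norm_num))
    simp [this, hx']

theorem Homeomorph.finrank_le_of_innerProductSpace {F : Type*} [NormedAddCommGroup F]
    [NormedSpace ℝ F] [FiniteDimensional ℝ F] (f : E ≃ₜ F) : finrank ℝ E ≤ finrank ℝ F := by
  by_contra! hlt
  obtain ⟨G, hG, hGf, -⟩ := f.symm.continuous.exists_contDiff_approx 1 (ε := fun _ => 1 / 4)
    continuous_const (fun _ => by norm_num)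
  have hG1 : ContDiff ℝ 1 G := by exact_mod_cast hG
  obtain ⟨c, hc, hcG⟩ := (hG1.dense_compl_range_of_finrank_lt_finrank hlt).exists_mem_open
    (isOpen_ball (x := (0 : E)) (ε := 1 / 4)) (nonempty_ball.2 (by norm_num))
  obtain ⟨x, hx⟩ := exists_eq_zero_of_norm_sub_lt (h := fun x => G (f x) - c)
    ((hG1.continuous.comp f.continuous).sub continuous_const) fun x => by
      have h1 := hGf (f x)
      rw [f.symm_apply_apply, dist_eq_norm] at h1
      have h2 : ‖c‖ < 1 / 4 := by simpa using hcG
      calc ‖G (f x) - c - x‖ = ‖(G (f x) - x) - c‖ := by congr 1; abel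
        _ ≤ ‖G (f x) - x‖ + ‖c‖ := norm_sub_le _ _
        _ < 1 / 2 := by linarith
  exact hc ⟨f x, sub_eq_zero.1 hx⟩

end

theorem Homeomorph.finrank_le {E F : Type*} [NormedAddCommGroup E] [NormedSpace ℝ E]
    [FiniteDimensional ℝ E] [NormedAddCommGroup F] [NormedSpace ℝ F] [FiniteDimensional ℝ F]
    (f : E ≃ₜ F) : finrank ℝ E ≤ finrank ℝ F := by
  simpa using (toEuclidean.symm.toHomeomorph.trans f).finrank_le_of_innerProductSpace

/-- **Invariance of dimension**: homeomorphic finite-dimensional real normed spaces have the same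
dimension. -/
theorem Homeomorph.finrank_eq {E F : Type*} [NormedAddCommGroup E] [NormedSpace ℝ E]
    [FiniteDimensional ℝ E] [NormedAddCommGroup F] [NormedSpace ℝ F] [FiniteDimensional ℝ F]
    (f : E ≃ₜ F) : finrank ℝ E = finrank ℝ F :=
  f.finrank_le.antisymm f.symm.finrank_le

theorem fin_complex_homeomorph_dim_eq {n m : ℕ} (φ : (Fin n → ℂ) ≃ₜ (Fin m → ℂ)) : n = m := by
  simpa [finrank_pi_fintype] using φ.finrank_eq

/-- Two surjections onto the same space from spaces of equal finite dimension differ by a linear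
equivalence of their sources. -/
theorem exists_linearEquiv_comp_eq {K V W Q : Type*} [Field K] [AddCommGroup V] [Module K V]
    [AddCommGroup W] [Module K W] [AddCommGroup Q] [Module K Q] [FiniteDimensional K V]
    [FiniteDimensional K W] (hVW : finrank K V = finrank K W) (L : V →ₗ[K] Q) (P : W →ₗ[K] Q)
    (hL : Function.Surjective L) (hP : Function.Surjective P) :
    ∃ ψ : V ≃ₗ[K] W, ∀ v, P (ψ v) = L v := by
  obtain ⟨S, hS⟩ := P.exists_rightInverse_of_surjective (LinearMap.range_eq_top.2 hP)
  obtain ⟨q, hq⟩ := (LinearMap.ker L).exists_isCompl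
  have hker : finrank K (LinearMap.ker L) = finrank K (LinearMap.ker P) := by
    have h1 := L.finrank_range_add_finrank_ker
    have h2 := P.finrank_range_add_finrank_ker
    rw [LinearMap.range_eq_top.2 hL] at h1
    rw [LinearMap.range_eq_top.2 hP] at h2
    omega
  let e : LinearMap.ker L ≃ₗ[K] LinearMap.ker P := LinearEquiv.ofFinrankEq _ _ hker
  let π := (LinearMap.ker L).projectionOnto q hq
  let ψ : V →ₗ[K] W := S ∘ₗ L + (LinearMap.ker P).subtype ∘ₗ e.toLinearMap ∘ₗ π
  have hψ : ∀ v, P (ψ v) = L v := fun v => by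
    have h1 : P (S (L v)) = L v := LinearMap.congr_fun hS (L v)
    have h2 : P (e (π v)) = 0 := (e (π v)).2
    simp [ψ, h1, h2]
  have hinj : Function.Injective ψ := by
    rw [← LinearMap.ker_eq_bot, LinearMap.ker_eq_bot']
    intro v hv
    have hLv : L v = 0 := by rw [← hψ, hv, map_zero]
    have h3 : π v = ⟨v, hLv⟩ :=
      Submodule.projectionOnto_apply_left hq ⟨v, hLv⟩
    have h4 : ((e (π v) : LinearMap.ker P) : W) = 0 := by simpa [ψ, hLv] using hv
    have h5 : π v = 0 := by simpa using h4
    rw [h3] at h5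
    exact congrArg Subtype.val h5
  exact ⟨LinearEquiv.ofInjectiveOfFinrankEq ψ hinj hVW, hψ⟩

/-- A surjective map `φ` between spaces of equal finite dimension can be replaced by a linear
equivalence that agrees with it after applying any functional `f` for which `f ∘ φ` is linear. -/
theorem exists_linearEquiv_dual_apply_eq {K V W : Type*} [Field K] [AddCommGroup V] [Module K V]
    [AddCommGroup W] [Module K W] [FiniteDimensional K V] [FiniteDimensional K W]
    (hVW : finrank K V = finrank K W) (φ : V → W) (hφ : Function.Surjective φ) :
    ∃ ψ : V ≃ₗ[K] W, ∀ (f : Dual K W) (g : Dual K V), (∀ u, f (φ u) = g u) →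
      ∀ u, f (ψ u) = f (φ u) := by
  let R : Submodule K W := ⨅ f : {f : Dual K W // ∃ g : Dual K V, ∀ u, f (φ u) = g u},
    LinearMap.ker f.1
  have hR : ∀ w, w ∈ R ↔ ∀ (f : Dual K W) (g : Dual K V), (∀ u, f (φ u) = g u) → f w = 0 := by
    intro w
    simp only [R, Submodule.mem_iInf, LinearMap.mem_ker, Subtype.forall, forall_exists_index]
  let L : V →ₗ[K] W ⧸ R :=
    { toFun := fun v => R.mkQ (φ v)
      map_add' := fun x y => by
        rw [← map_add, ← sub_eq_zero, ← map_sub, Submodule.mkQ_apply, Submodule.Quotient.mk_eq_zero,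
          hR]
        intro f g h
        simp [h]
      map_smul' := fun c x => by
        rw [RingHom.id_apply, ← map_smul, ← sub_eq_zero, ← map_sub, Submodule.mkQ_apply,
          Submodule.Quotient.mk_eq_zero, hR]
        intro f g h
        simp [h] }
  obtain ⟨ψ, hψ⟩ := exists_linearEquiv_comp_eq hVW L R.mkQ (R.mkQ_surjective.comp hφ)
    R.mkQ_surjective
  refine ⟨ψ, fun f g h u => ?_⟩
  have h1 : R.mkQ (ψ u - φ u) = 0 := by rw [map_sub, hψ]; exact sub_self _
  rw [Submodule.mkQ_apply, Submodule.Quotient.mk_eq_zero, hR] at h1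
  simpa [sub_eq_zero] using h1 f g h

/-- **Topological classification of systems of bilinear and sesquilinear forms.**
Let `𝒜` and `ℬ` be two systems consisting of vector spaces `ℂ^{n 1}, …, ℂ^{n t}`
(resp. `ℂ^{m 1}, …, ℂ^{m t}`) together with bilinear forms
`A i : ℂ^{n (k₁ i)} × ℂ^{n (l₁ i)} → ℂ` and sesquilinear forms
`A' j : ℂ^{n (k₂ j)} × ℂ^{n (l₂ j)} → ℂ` (linear in the first argument,
conjugate-linear in the second), and similarly `B i`, `B' j` for `ℬ`.
Then `𝒜` is transformed to `ℬ` by a family of homeomorphisms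
`φ p : ℂ^{n p} → ℂ^{m p}` if and only if it is transformed to `ℬ` by a family of
linear bijections `ψ p : ℂ^{n p} → ℂ^{m p}`. -/
theorem stmt_0 (t s₁ s₂ : ℕ) (n m : Fin t → ℕ)
    (k₁ l₁ : Fin s₁ → Fin t) (k₂ l₂ : Fin s₂ → Fin t)
    (A : ∀ i : Fin s₁, (Fin (n (k₁ i)) → ℂ) →ₗ[ℂ] (Fin (n (l₁ i)) → ℂ) →ₗ[ℂ] ℂ)
    (A' : ∀ j : Fin s₂,
      (Fin (n (k₂ j)) → ℂ) →ₗ[ℂ] (Fin (n (l₂ j)) → ℂ) →ₛₗ[starRingEnd ℂ] ℂ)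
    (B : ∀ i : Fin s₁, (Fin (m (k₁ i)) → ℂ) →ₗ[ℂ] (Fin (m (l₁ i)) → ℂ) →ₗ[ℂ] ℂ)
    (B' : ∀ j : Fin s₂,
      (Fin (m (k₂ j)) → ℂ) →ₗ[ℂ] (Fin (m (l₂ j)) → ℂ) →ₛₗ[starRingEnd ℂ] ℂ) :
    (∃ φ : ∀ p : Fin t, (Fin (n p) → ℂ) ≃ₜ (Fin (m p) → ℂ),
      (∀ (i : Fin s₁) (u : Fin (n (k₁ i)) → ℂ) (v : Fin (n (l₁ i)) → ℂ),
        A i u v = B i (φ (k₁ i) u) (φ (l₁ i) v)) ∧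
      (∀ (j : Fin s₂) (u : Fin (n (k₂ j)) → ℂ) (v : Fin (n (l₂ j)) → ℂ),
        A' j u v = B' j (φ (k₂ j) u) (φ (l₂ j) v))) ↔
    (∃ ψ : ∀ p : Fin t, (Fin (n p) → ℂ) ≃ₗ[ℂ] (Fin (m p) → ℂ),
      (∀ (i : Fin s₁) (u : Fin (n (k₁ i)) → ℂ) (v : Fin (n (l₁ i)) → ℂ),
        A i u v = B i (ψ (k₁ i) u) (ψ (l₁ i) v)) ∧
      (∀ (j : Fin s₂) (u : Fin (n (k₂ j)) → ℂ) (v : Fin (n (l₂ j)) → ℂ),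
        A' j u v = B' j (ψ (k₂ j) u) (ψ (l₂ j) v))) := by
  constructor
  · rintro ⟨φ, hφ, hφ'⟩
    choose ψ hψ using fun p => exists_linearEquiv_dual_apply_eq (K := ℂ)
      (by simpa using fin_complex_homeomorph_dim_eq (φ p)) (φ p) (φ p).surjective
    refine ⟨ψ, fun i u v => ?_, fun j u v => ?_⟩
    · have hl : B i (ψ (k₁ i) u) (ψ (l₁ i) v) = B i (φ (k₁ i) u) (ψ (l₁ i) v) := by
        obtain ⟨v', hv'⟩ := (φ (l₁ i)).surjective (ψ (l₁ i) v)
        exact hψ (k₁ i) ((B i).flip (ψ (l₁ i) v)) ((A i).flip v')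
          (fun u => by simp [hφ, hv']) u
      have hr : B i (φ (k₁ i) u) (ψ (l₁ i) v) = B i (φ (k₁ i) u) (φ (l₁ i) v) :=
        hψ (l₁ i) (B i (φ (k₁ i) u)) (A i u) (fun v => (hφ i u v).symm) v
      rw [hl, hr, hφ]
    · have hl : B' j (ψ (k₂ j) u) (ψ (l₂ j) v) = B' j (φ (k₂ j) u) (ψ (l₂ j) v) := by
        obtain ⟨v', hv'⟩ := (φ (l₂ j)).surjective (ψ (l₂ j) v)
        exact hψ (k₂ j) ((B' j).flip (ψ (l₂ j) v)) ((A' j).flip v')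
          (fun u => by simp [hφ', hv']) u
      let conj : ℂ →ₛₗ[starRingEnd ℂ] ℂ := (starLinearEquiv ℂ (A := ℂ)).toLinearMap
      have hr : B' j (φ (k₂ j) u) (ψ (l₂ j) v) = B' j (φ (k₂ j) u) (φ (l₂ j) v) :=
        star_injective <| hψ (l₂ j) (conj.comp (B' j (φ (k₂ j) u))) (conj.comp (A' j u))
          (fun v => by simp [hφ']) v
      rw [hl, hr, hφ']
  · rintro ⟨ψ, hψ, hψ'⟩
    exact ⟨fun p => (ψ p).toContinuousLinearEquiv.toHomeomorph, hψ, hψ'⟩
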